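/- Let s ∈ ℕ. Then for every k ∈ ℤ it holds that K_z(k) converges, as z → s with z ∈ (0,∞) ∖ ℕ, to the value 𝟙_{k≠0} · (−1)^{k+1} Γ(2s + 1) / (Γ(1 + s + k) Γ(1 + s − k)), where by the convention 1/Γ(nonpositive integer) = 0 this limit vanishes for all k with |k| > s. -/

import Mathlib

/-- The fractional kernel `K_z : ℤ → ℝ`, defined by `K_z(0) = 0` and
`K_z(k) = −4^z Γ(1/2 + z) Γ(|k| − z) / (√π Γ(−z) Γ(|k| + 1 + z))` for `k ≠ 0`. -/
noncomputable def fracKer (z : ℝ) (k : ℤ) : ℝ :=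
  if k = 0 then 0
  else -((4 : ℝ) ^ z * Real.Gamma (1 / 2 + z) * Real.Gamma (|(k : ℝ)| - z)) /
    (Real.sqrt Real.pi * Real.Gamma (-z) * Real.Gamma (|(k : ℝ)| + 1 + z))

open Finset in
/-- The recursion of the Gamma function, iterated `n` times from `-z`. -/
theorem Gamma_natCast_sub_eq_mul_prod {z : ℝ} (hz : ∀ j : ℕ, z ≠ j) (n : ℕ) :
    Real.Gamma (n - z) = Real.Gamma (-z) * ∏ j ∈ range n, ((j : ℝ) - z) := by
  induction n with
  | zero => simp
  | succ n ih =>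
    have h : (n : ℝ) - z ≠ 0 := sub_ne_zero.mpr (hz n).symm
    rw [prod_range_succ, ← mul_assoc, ← ih, mul_comm, ← Real.Gamma_add_one h]
    congr 1
    push_cast
    ring

open Finset in
/-- Dividing the falling product by `Γ(1 + x)` gives `±1 / Γ(1 + x - n)`, with the convention
`1 / Γ = 0` at the poles. -/
theorem prod_sub_div_Gamma_eq (x : ℝ) (n : ℕ) :
    (∏ j ∈ range n, ((j : ℝ) - x)) / Real.Gamma (1 + x) =
      (-1) ^ n / Real.Gamma (1 + x - n) := by
  induction n with
  | zero => simp
  | succ n ih =>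
    have h : (x - n) / Real.Gamma (1 + x - n) = 1 / Real.Gamma (x - n) := by
      rcases eq_or_ne (x - n) 0 with h | h
      · simp [h]
      · rw [show 1 + x - n = (x - n) + 1 by ring, Real.Gamma_add_one h,
          div_mul_cancel_left₀ h, one_div]
    rw [prod_range_succ, mul_div_right_comm, ih,
      show 1 + x - ((n + 1 : ℕ) : ℝ) = x - n by push_cast; ring, div_mul_eq_mul_div]
    linear_combination (-1) * (-1) ^ n * h

/-- Legendre's duplication formula, normalised at `z + 1 / 2`. -/
theorem four_rpow_mul_Gamma_half_add (z : ℝ) :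
    (4 : ℝ) ^ z * Real.Gamma (1 / 2 + z) * Real.Gamma (1 + z) =
      √Real.pi * Real.Gamma (2 * z + 1) := by
  have h := Real.Gamma_mul_Gamma_add_half (1 / 2 + z)
  rw [show 1 / 2 + z + 1 / 2 = 1 + z by ring, show 2 * (1 / 2 + z) = 2 * z + 1 by ring,
    show 1 - (2 * z + 1) = -(2 * z) by ring, Real.rpow_neg two_pos.le,
    Real.rpow_mul two_pos.le, show (2 : ℝ) ^ (2 : ℝ) = 4 by norm_num] at h
  have h4 : (4 : ℝ) ^ z ≠ 0 := by positivity
  rw [mul_assoc, h]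
  field_simp

open Finset in
/-- The kernel away from the origin, with the factor `Γ(-z)` cancelled. -/
theorem fracKer_eq_prod {z : ℝ} (hz : ∀ j : ℕ, z ≠ j) {k : ℤ} (hk : k ≠ 0) :
    fracKer z k = -((4 : ℝ) ^ z * Real.Gamma (1 / 2 + z) *
      ∏ j ∈ range k.natAbs, ((j : ℝ) - z)) /
        (√Real.pi * Real.Gamma (k.natAbs + 1 + z)) := by
  have hΓ : Real.Gamma (-z) ≠ 0 :=
    Real.Gamma_ne_zero fun m h => hz m (neg_injective h)
  rw [fracKer, if_neg hk, ← Int.cast_abs, ← Nat.cast_natAbs, Gamma_natCast_sub_eq_mul_prod hz,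
    mul_right_comm √Real.pi, ← mul_assoc, mul_right_comm _ (Real.Gamma (-z)), ← neg_mul,
    mul_div_mul_right _ _ hΓ]

open Finset in
/-- The value at `z = x` of the expression in `fracKer_eq_prod`. -/
theorem neg_four_rpow_mul_prod_div_eq {x : ℝ} (hx : 0 < x) (n : ℕ) :
    -((4 : ℝ) ^ x * Real.Gamma (1 / 2 + x) * ∏ j ∈ range n, ((j : ℝ) - x)) /
        (√Real.pi * Real.Gamma (n + 1 + x)) =
      (-1) ^ (n + 1) * Real.Gamma (2 * x + 1) /
        (Real.Gamma (1 + x + n) * Real.Gamma (1 + x - n)) := by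
  have h1 : Real.Gamma (1 + x) ≠ 0 := (Real.Gamma_pos_of_pos (by positivity)).ne'
  have hπ : √Real.pi ≠ 0 := by positivity
  have hP := (div_eq_iff h1).mp (prod_sub_div_Gamma_eq x n)
  rw [hP, show (n : ℝ) + 1 + x = 1 + x + n by ring, pow_succ]
  calc _ = -((4 : ℝ) ^ x * Real.Gamma (1 / 2 + x) * Real.Gamma (1 + x)) * (-1) ^ n /
        (√Real.pi * (Real.Gamma (1 + x + n) * Real.Gamma (1 + x - n))) := by ring
    _ = √Real.pi * (-Real.Gamma (2 * x + 1) * (-1) ^ n) /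
        (√Real.pi * (Real.Gamma (1 + x + n) * Real.Gamma (1 + x - n))) := by
      rw [four_rpow_mul_Gamma_half_add]; ring
    _ = _ := by rw [mul_div_mul_left _ _ hπ]; ring

/-- Let `s ∈ ℕ = {1,2,…}`. Then for every `k ∈ ℤ`, as `z → s` with
`z ∈ (0,∞) ∖ ℕ`, the kernel value `K_z(k)` converges to
`𝟙_{k≠0} (−1)^{k+1} Γ(2s+1)/(Γ(1+s+k)Γ(1+s−k))`; by the convention
`1/Γ(nonpositive integer) = 0` (realized in Lean by `Real.Gamma` vanishing at
nonpositive integers and `x/0 = 0`) this limit vanishes whenever `|k| > s`. -/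
theorem stmt18 (s : ℕ) (hs : 1 ≤ s) (k : ℤ) :
    Filter.Tendsto (fun z : ℝ => fracKer z k)
      (nhdsWithin (s : ℝ) {z : ℝ | 0 < z ∧ ∀ j : ℕ, z ≠ (j : ℝ)})
      (nhds (if k = 0 then 0 else
        (-1 : ℝ) ^ (k + 1) * Real.Gamma (2 * (s : ℝ) + 1) /
          (Real.Gamma (1 + (s : ℝ) + (k : ℝ)) * Real.Gamma (1 + (s : ℝ) - (k : ℝ))))) := by
  rcases eq_or_ne k 0 with rfl | hk
  · simpa [fracKer] using tendsto_const_nhds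
  have hs0 : (0 : ℝ) < s := by exact_mod_cast hs
  have hlim : (-1 : ℝ) ^ (k + 1) * Real.Gamma (2 * (s : ℝ) + 1) /
      (Real.Gamma (1 + (s : ℝ) + (k : ℝ)) * Real.Gamma (1 + (s : ℝ) - (k : ℝ))) =
      (-1) ^ (k.natAbs + 1) * Real.Gamma (2 * (s : ℝ) + 1) /
        (Real.Gamma (1 + s + k.natAbs) * Real.Gamma (1 + s - k.natAbs)) := by
    rw [zpow_add₀ (by norm_num)]
    obtain ⟨n, rfl | rfl⟩ := k.eq_nat_or_neg
    · simp [pow_succ]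
    · simp [pow_succ, ← inv_pow, mul_comm (Real.Gamma (1 + s + n)), sub_eq_add_neg]
  rw [if_neg hk, hlim, ← neg_four_rpow_mul_prod_div_eq hs0]
  refine Filter.Tendsto.congr' (f₁ := fun z : ℝ => -((4 : ℝ) ^ z * Real.Gamma (1 / 2 + z) *
      ∏ j ∈ Finset.range k.natAbs, ((j : ℝ) - z)) /
        (√Real.pi * Real.Gamma (k.natAbs + 1 + z))) ?_ ?_
  · filter_upwards [self_mem_nhdsWithin] with z hz
    exact (fracKer_eq_prod hz.2 hk).symm
  · refine Filter.Tendsto.mono_left (ContinuousAt.tendsto ?_) nhdsWithin_le_nhds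
    have hΓ (a : ℝ) (ha : 0 < a) : ContinuousAt (fun z : ℝ => Real.Gamma (a + z)) s :=
      ContinuousAt.comp (g := Real.Gamma) (Real.differentiableAt_Gamma
        fun m => by have := m.cast_nonneg (α := ℝ); linarith).continuousAt (by fun_prop)
    have h4 : ContinuousAt (fun z : ℝ => (4 : ℝ) ^ z) s :=
      Real.continuousAt_const_rpow (by norm_num)
    have hΓ1 := hΓ (1 / 2) (by norm_num)
    have hΓ2 := hΓ (k.natAbs + 1) (by positivity)
    refine ContinuousAt.div (by fun_prop) (by fun_prop) (mul_ne_zero (by positivity) ?_)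
    exact (Real.Gamma_pos_of_pos (by positivity)).ne'
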